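/- Let n and k be integers with k ≥ 1 and n > 2k, let U be the standard bubble, and define Z₀(x) := (n−2k)/2 · U(x) + ⟨x, ∇U(x)⟩ for x ∈ ℝⁿ. Then Δ₀^k Z₀ = (2*_k − 1) · U^{2*_k−2} · Z₀ on ℝⁿ. -/

import Mathlib

open MeasureTheory Metric Filter
open scoped RealInnerProductSpace

noncomputable section

/-- The nonnegative Euclidean Laplacian `Δ₀ u = -∑ᵢ ∂²u/∂xᵢ²` on `ℝⁿ`. -/
def lap (n : ℕ) (u : EuclideanSpace ℝ (Fin n) → ℝ) :
    EuclideanSpace ℝ (Fin n) → ℝ := fun x =>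
  -∑ i : Fin n, iteratedFDeriv ℝ 2 u x
      ![EuclideanSpace.single i (1:ℝ), EuclideanSpace.single i (1:ℝ)]

/-- The iterated Laplacian `Δ₀^k`. -/
def lapIter (n k : ℕ) (u : EuclideanSpace ℝ (Fin n) → ℝ) :
    EuclideanSpace ℝ (Fin n) → ℝ := (lap n)^[k] u

/-- The radial derivative `⟨x, ∇u(x)⟩`. -/
def xGrad (n : ℕ) (u : EuclideanSpace ℝ (Fin n) → ℝ)
    (x : EuclideanSpace ℝ (Fin n)) : ℝ := ⟪x, gradient u x⟫

/-- The constant `𝔠_{n,k} = (∏_{j=-k}^{k-1} (n+2j))^{1/k}`. -/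
def cnk (n k : ℕ) : ℝ :=
  (∏ j ∈ Finset.Icc (-(k:ℤ)) ((k:ℤ) - 1), ((n:ℝ) + 2*(j:ℝ))) ^ ((1:ℝ)/k)

/-- The standard bubble `U(x) = (1 + 𝔠_{n,k}⁻¹ |x|²)^{-(n-2k)/2}`. -/
def bubble (n k : ℕ) (x : EuclideanSpace ℝ (Fin n)) : ℝ :=
  (1 + (cnk n k)⁻¹ * ‖x‖^2) ^ (-((n - 2*k : ℝ)/2))

def Wf (n : ℕ) (a q : ℝ) (x : EuclideanSpace ℝ (Fin n)) : ℝ := (1 + a * ‖x‖^2) ^ (-q)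

lemma Wf_pos' {n : ℕ} {a : ℝ} (ha : 0 < a) (x : EuclideanSpace ℝ (Fin n)) :
    0 < 1 + a * ‖x‖^2 := by positivity

lemma Wf_hasFDerivAt {n : ℕ} {a : ℝ} (ha : 0 < a) (q : ℝ) (x : EuclideanSpace ℝ (Fin n)) :
    HasFDerivAt (Wf n a q) ((-2 * a * q * Wf n a (q+1) x) • innerSL ℝ x) x := by
  have h1 : HasFDerivAt (fun y : EuclideanSpace ℝ (Fin n) => 1 + a * ‖y‖^2)
      (a • (2 • innerSL ℝ x)) x :=
    (((hasStrictFDerivAt_norm_sq x).hasFDerivAt).const_mul a).const_add 1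
  have h2 := h1.rpow_const (p := -q) (Or.inl (Wf_pos' ha x).ne')
  refine h2.congr_fderiv ?_
  ext v
  simp [Wf, show -q - 1 = -1 + -q by ring]
  ring

lemma Wf_contDiff {n : ℕ} {a : ℝ} (ha : 0 < a) (q : ℝ) : ContDiff ℝ 2 (Wf n a q) := by
  unfold Wf
  refine ContDiff.rpow_const_of_ne ?_ (fun x => (Wf_pos' ha x).ne')
  exact contDiff_const.add (contDiff_const.mul (contDiff_norm_sq ℝ))

lemma Wf_succ {n : ℕ} {a : ℝ} (ha : 0 < a) (q : ℝ) (x : EuclideanSpace ℝ (Fin n)) :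
    Wf n a q x = (1 + a * ‖x‖^2) * Wf n a (q+1) x := by
  have := Wf_pos' ha x
  unfold Wf
  rw [show -q = 1 + -(q+1) by ring, Real.rpow_add this, Real.rpow_one]

lemma lap_Wf {n : ℕ} {a : ℝ} (ha : 0 < a) (q : ℝ) (x : EuclideanSpace ℝ (Fin n)) :
    lap n (Wf n a q) x = 4 * a * q * (((n:ℝ)/2 - 1 - q) * Wf n a (q+1) x
      + (q+1) * Wf n a (q+2) x) := by
  have hf : fderiv ℝ (Wf n a q) = fun y => (-2 * a * q * Wf n a (q+1) y) • innerSL ℝ y := by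
    ext1 y
    exact (Wf_hasFDerivAt ha q y).fderiv
  have h2 : ∀ v : EuclideanSpace ℝ (Fin n), iteratedFDeriv ℝ 2 (Wf n a q) x ![v, v]
      = -2 * a * q * (Wf n a (q+1) x * ‖v‖^2
        - 2 * a * (q+1) * Wf n a (q+2) x * (inner ℝ x v)^2) := by
    intro v
    rw [iteratedFDeriv_two_apply, hf]
    have h3 := ((Wf_hasFDerivAt ha (q+1) x).const_mul (-2 * a * q)).smul
      ((innerSL ℝ (E := EuclideanSpace ℝ (Fin n))).hasFDerivAt (x := x))
    have h4 := congrArg (fun L => L v v) h3.fderiv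
    simp only [Matrix.cons_val_zero, Matrix.cons_val_one]
    refine h4.trans ?_
    have hvv : inner ℝ v v = ‖v‖^2 := real_inner_self_eq_norm_sq v
    have hvv' : (innerSL ℝ) v v = ‖v‖^2 := hvv
    have hxv : (innerSL ℝ) x v = inner ℝ x v := rfl
    simp [show q + 1 + 1 = q + 2 by ring]
    rw [hvv', hxv]
    ring
  unfold lap
  simp only [h2]
  rw [← Finset.mul_sum, Finset.sum_sub_distrib, ← Finset.mul_sum, ← Finset.mul_sum]
  have e1 : ∑ i : Fin n, ‖(EuclideanSpace.single i (1:ℝ) : EuclideanSpace ℝ (Fin n))‖^2 = n := by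
    simp
  have e2 : ∑ i : Fin n, (inner ℝ x (EuclideanSpace.single i (1:ℝ)))^2 = ‖x‖^2 := by
    rw [EuclideanSpace.norm_sq_eq]
    refine Finset.sum_congr rfl fun i _ => ?_
    rw [EuclideanSpace.inner_single_right]
    simp
  rw [e1, e2]
  have h5 := Wf_succ ha (q+1) x
  rw [show q + 1 + 1 = q + 2 by ring] at h5
  rw [h5]
  ring

lemma lap_sum {n : ℕ} {ι : Type*} (s : Finset ι) (c : ι → ℝ)
    (f : ι → EuclideanSpace ℝ (Fin n) → ℝ) (hf : ∀ i ∈ s, ContDiff ℝ 2 (f i)) :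
    lap n (fun x => ∑ i ∈ s, c i * f i x) = fun x => ∑ i ∈ s, c i * lap n (f i) x := by
  ext x
  have h1 : ∀ v, iteratedFDeriv ℝ 2 (fun x => ∑ i ∈ s, c i * f i x) x v
      = ∑ i ∈ s, c i * iteratedFDeriv ℝ 2 (f i) x v := by
    intro v
    rw [iteratedFDeriv_fun_sum_apply (fun i hi => (contDiff_const.mul (hf i hi)).contDiffAt)]
    simp only [ContinuousMultilinearMap.sum_apply]
    refine Finset.sum_congr rfl fun i hi => ?_
    have := iteratedFDeriv_const_smul_apply (a := c i) (hf i hi).contDiffAt (x := x)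
    have h := congrArg (fun L => L v) this
    exact h
  unfold lap
  simp only [h1]
  rw [Finset.sum_comm]
  simp only [← Finset.mul_sum, mul_neg, Finset.sum_neg_distrib]

def Ac (κ : ℝ) (j i : ℕ) : ℝ := (j.choose i : ℝ) * ∏ l ∈ Finset.Ico i j, (κ - 1 - l)

lemma Ac_zero (κ : ℝ) (j : ℕ) : Ac κ (j+1) 0 = Ac κ j 0 * (κ - 1 - j) := by
  simp [Ac, Finset.prod_range_succ]

lemma Ac_top (κ : ℝ) (j : ℕ) : Ac κ j (j+1) = 0 := by simp [Ac]

lemma Ac_succ (κ : ℝ) (j i : ℕ) :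
    Ac κ (j+1) (i+1) = Ac κ j (i+1) * (κ - 1 - j - (i+1)) + Ac κ j i := by
  rcases lt_trichotomy i j with h | h | h
  · unfold Ac
    rw [Finset.prod_Ico_succ_top (by omega), Finset.prod_eq_prod_Ico_succ_bot h,
      Nat.choose_succ_succ]
    have h1 : ((j.choose (i+1) : ℕ) : ℝ) * (i + 1) = j.choose i * (j - i) := by
      have := Nat.choose_succ_right_eq j i
      rw [← Nat.cast_sub h.le]
      exact_mod_cast this
    push_cast
    linear_combination (∏ l ∈ Finset.Ico (i+1) j, (κ - 1 - (l:ℝ))) * h1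
  · subst h
    simp [Ac]
  · simp [Ac, Nat.choose_eq_zero_of_lt h, Nat.choose_eq_zero_of_lt (show j < i + 1 by omega),
      Nat.choose_eq_zero_of_lt (show j + 1 < i + 1 by omega)]

lemma lapIter_Wf {n : ℕ} {a : ℝ} (ha : 0 < a) (p : ℝ) (j : ℕ) :
    lapIter n j (Wf n a p) = fun x => ∑ i ∈ Finset.range (j+1),
      ((4*a)^j * Ac ((n:ℝ)/2 - p) j i * (ascPochhammer ℝ (j+i)).eval p)
        * Wf n a (p + j + i) x := by
  induction j with
  | zero => ext x; simp [lapIter, Ac]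
  | succ j ih =>
    have : lapIter n (j+1) (Wf n a p) = lap n (lapIter n j (Wf n a p)) := by
      unfold lapIter
      rw [Function.iterate_succ_apply']
    rw [this, ih, lap_sum _ _ _ (fun i _ => Wf_contDiff ha _)]
    ext x
    set κ := (n:ℝ)/2 - p with hκ
    set g : ℕ → ℝ := fun i => (4*a)^(j+1) * (ascPochhammer ℝ (j+1+i)).eval p
        * Wf n a (p + (j+1:ℕ) + i) x with hg
    have hL : ∀ i ∈ Finset.range (j+1),
        ((4*a)^j * Ac κ j i * (ascPochhammer ℝ (j+i)).eval p) * lap n (Wf n a (p + j + i)) x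
        = Ac κ j i * (κ - 1 - j - i) * g i + Ac κ j i * g (i+1) := by
      intro i _
      rw [lap_Wf ha]
      simp only [hg]
      rw [show j + 1 + (i + 1) = (j + i + 1) + 1 by ring, show j + 1 + i = j + i + 1 by ring,
        ascPochhammer_succ_eval (j+i+1), ascPochhammer_succ_eval (j+i)]
      push_cast
      rw [show p + (↑j + 1) + (i:ℝ) = p + j + i + 1 by ring,
        show p + (↑j + 1) + ((i:ℝ) + 1) = p + j + i + 2 by ring]
      rw [hκ]
      ring
    rw [Finset.sum_congr rfl hL, Finset.sum_add_distrib]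
    have hR : ∀ i ∈ Finset.range (j+1+1),
        ((4*a)^(j+1) * Ac κ (j+1) i * (ascPochhammer ℝ (j+1+i)).eval p)
          * Wf n a (p + (j+1:ℕ) + i) x = Ac κ (j+1) i * g i := by
      intro i _
      simp only [hg]; ring
    rw [Finset.sum_congr rfl hR, Finset.sum_range_succ' _ (j+1)]
    simp only [Ac_succ, Ac_zero, add_mul, Finset.sum_add_distrib]
    have e : ∑ i ∈ Finset.range (j+1), Ac κ j i * (κ - 1 - j - i) * g i
        = ∑ i ∈ Finset.range (j+1), Ac κ j (i+1) * (κ - 1 - j - (i+1)) * g (i+1)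
          + Ac κ j 0 * (κ - 1 - j) * g 0 := by
      have e1 := Finset.sum_range_succ (fun i : ℕ => Ac κ j i * (κ - 1 - j - i) * g i) (j+1)
      rw [Finset.sum_range_succ' _ (j+1)] at e1
      simp only [Ac_top] at e1
      push_cast at e1
      simp only [zero_mul, add_zero, sub_zero] at e1
      exact e1.symm
    rw [e]
    ring

lemma Ac_k (k i : ℕ) (h : i < k) : Ac k k i = 0 := by
  unfold Ac
  rw [Finset.prod_eq_zero (i := k - 1)]
  · simp
  · simp; omega
  · rw [Nat.cast_sub (by omega)]; simp

lemma Ac_k1 (k i : ℕ) (h : i + 1 < k) : Ac ((k:ℝ) - 1) k i = 0 := by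
  unfold Ac
  rw [Finset.prod_eq_zero (i := k - 2)]
  · simp
  · simp; omega
  · rw [Nat.cast_sub (by omega)]; push_cast; ring

lemma Ac_self (κ : ℝ) (k : ℕ) : Ac κ k k = 1 := by simp [Ac]

lemma lapIter_W1 {n k : ℕ} {a : ℝ} (ha : 0 < a) (p : ℝ) (hp : p = (n:ℝ)/2 - k)
    (x : EuclideanSpace ℝ (Fin n)) :
    lapIter n k (Wf n a p) x = (4*a)^k * (ascPochhammer ℝ (2*k)).eval p * Wf n a (p+2*k) x := by
  rw [lapIter_Wf ha, show (n:ℝ)/2 - p = k by rw [hp]; ring]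
  simp only
  rw [Finset.sum_range_succ, Finset.sum_eq_zero, Ac_self]
  · rw [show k + k = 2 * k by ring, show p + k + (k:ℝ) = p + 2 * k by ring]; ring
  · intro i hi
    rw [Ac_k _ _ (Finset.mem_range.1 hi)]; ring

lemma lapIter_W2 {n k : ℕ} (hk : 1 ≤ k) {a : ℝ} (ha : 0 < a) (p : ℝ) (hp : p = (n:ℝ)/2 - k)
    (x : EuclideanSpace ℝ (Fin n)) :
    p * lapIter n k (Wf n a (p+1)) x = (4*a)^k * (ascPochhammer ℝ (2*k)).eval p *
      (-k * Wf n a (p+2*k) x + (p + 2*k) * Wf n a (p+2*k+1) x) := by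
  obtain ⟨k, rfl⟩ : ∃ m, k = m + 1 := ⟨k - 1, by omega⟩
  rw [lapIter_Wf ha, show (n:ℝ)/2 - (p+1) = ((k+1:ℕ):ℝ) - 1 by rw [hp]; ring]
  simp only
  rw [Finset.sum_range_succ, Finset.sum_range_succ, Finset.sum_eq_zero, Ac_self]
  · have hA : Ac (((k+1:ℕ):ℝ) - 1) (k+1) k = -(k+1) := by
      simp [Ac]
    have hasc : ∀ m : ℕ, (ascPochhammer ℝ (m+1)).eval p
        = p * (ascPochhammer ℝ m).eval (p+1) := by
      intro m
      rw [ascPochhammer_succ_left]; simp [Polynomial.eval_comp]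
    have h1 := hasc (2*k+1)
    have h2 := hasc (2*k+2)
    rw [ascPochhammer_succ_eval] at h2
    rw [hA]
    rw [show k + 1 + (k + 1) = 2 * k + 2 by ring, show k + 1 + k = 2 * k + 1 by ring,
      show 2 * (k+1) = 2 * k + 1 + 1 by ring]
    push_cast at h2 ⊢
    rw [show p + 1 + ((k:ℝ)+1) + k = p + 2 * (k+1) by ring,
      show p + 1 + ((k:ℝ)+1) + (k+1) = p + 2 * (k+1) + 1 by ring]
    linear_combination (4*a)^(k+1) * (k+1) * Wf n a (p + 2 * (k+1)) x * h1
      - (4*a)^(k+1) * Wf n a (p + 2 * (k+1) + 1) x * h2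
  · intro i hi
    rw [Ac_k1 _ _ (by have := Finset.mem_range.1 hi; omega)]; ring

lemma cprod_eq (n k : ℕ) : ∏ j ∈ Finset.Icc (-(k:ℤ)) ((k:ℤ) - 1), ((n:ℝ) + 2*(j:ℝ))
    = 4^k * (ascPochhammer ℝ (2*k)).eval ((n:ℝ)/2 - k) := by
  have h1 : ∀ m : ℕ, ∏ i ∈ Finset.range m, ((n:ℝ) + 2 * ((i:ℝ) - k))
      = 2^m * (ascPochhammer ℝ m).eval ((n:ℝ)/2 - k) := by
    intro m
    induction m with
    | zero => simp
    | succ m ih => rw [Finset.prod_range_succ, ih, ascPochhammer_succ_eval]; ring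
  rw [show (4:ℝ) = 2^2 by norm_num, ← pow_mul, ← h1]
  symm
  refine Finset.prod_bij (fun i _ => (i:ℤ) - k) ?_ ?_ ?_ ?_
  · intro i hi; simp at hi ⊢; omega
  · intro i _ j _ h; simpa using h
  · intro j hj
    simp at hj
    exact ⟨(j + k).toNat, by simp; omega, by omega⟩
  · intro i _; push_cast; ring

/-- `Z₀ := (n−2k)/2 · U + ⟨x,∇U⟩` solves the linearized equation
`Δ₀^k Z₀ = (2*_k − 1) U^{2*_k − 2} Z₀`, with `2*_k = 2n/(n−2k)`. -/
theorem bubble_linearized_equation (n k : ℕ) (hk : 1 ≤ k) (hn : 2*k < n) :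
    ∀ x : EuclideanSpace ℝ (Fin n),
      lapIter n k (fun y => (n - 2*k : ℝ)/2 * bubble n k y + xGrad n (bubble n k) y) x
        = (2*(n:ℝ)/((n:ℝ) - 2*k) - 1) * bubble n k x ^ (2*(n:ℝ)/((n:ℝ) - 2*k) - 2)
            * ((n - 2*k : ℝ)/2 * bubble n k x + xGrad n (bubble n k) x) := by
  intro x
  set p : ℝ := (n:ℝ)/2 - k with hp
  have hnk : (0:ℝ) < (n:ℝ) - 2*k := by
    have : (2*(k:ℝ)) < n := by exact_mod_cast hn
    linarith
  have hp2 : ((n:ℝ) - 2*k) = 2 * p := by rw [hp]; ring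
  have hp0 : 0 < p := by linarith
  set c := cnk n k with hc
  have hk0 : (k:ℝ) ≠ 0 := by positivity
  have hasc : 0 < (ascPochhammer ℝ (2*k)).eval p := ascPochhammer_pos _ _ hp0
  have hpos : (0:ℝ) < 4^k * (ascPochhammer ℝ (2*k)).eval p := by positivity
  have hc0 : 0 < c := by
    rw [hc, cnk, cprod_eq]; exact Real.rpow_pos_of_pos hpos _
  have hck : c^k = 4^k * (ascPochhammer ℝ (2*k)).eval p := by
    rw [hc, cnk, cprod_eq, ← Real.rpow_natCast, ← Real.rpow_mul hpos.le, one_div,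
      inv_mul_cancel₀ hk0, Real.rpow_one]
  set a := c⁻¹ with ha'
  have ha : 0 < a := inv_pos.2 hc0
  have hone : (4*a)^k * (ascPochhammer ℝ (2*k)).eval p = 1 := by
    rw [mul_pow, ha', inv_pow, mul_right_comm, ← hck]
    exact mul_inv_cancel₀ (by positivity)
  have hU : bubble n k = Wf n a p := by
    ext y
    unfold bubble Wf
    rw [show ((n:ℝ) - 2*k)/2 = p by rw [hp]; ring]
  have hX : ∀ y, xGrad n (bubble n k) y = -2 * p * (Wf n a p y - Wf n a (p+1) y) := by
    intro y
    rw [hU, xGrad, real_inner_comm, gradient, InnerProductSpace.toDual_symm_apply,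
      (Wf_hasFDerivAt ha p y).fderiv, Wf_succ ha p y]
    simp
    ring
  have hZ : ∀ y, ((n:ℝ) - 2*k)/2 * bubble n k y + xGrad n (bubble n k) y
      = p * (2 * Wf n a (p+1) y - Wf n a p y) := by
    intro y
    rw [hX, hU, hp2]; ring
  simp only [hZ]
  have hlin : ∀ j : ℕ, lapIter n j (fun y => p * (2 * Wf n a (p+1) y - Wf n a p y)) 
      = fun y => 2 * p * lapIter n j (Wf n a (p+1)) y + (-p) * lapIter n j (Wf n a p) y := by
    intro j
    induction j with
    | zero => ext y; simp [lapIter]; ring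
    | succ j ih =>
      have hs : ∀ u, lapIter n (j+1) u = lap n (lapIter n j u) := by
        intro u
        unfold lapIter
        rw [Function.iterate_succ_apply']
      rw [hs, hs, hs, ih]
      have hcd : ∀ q, ContDiff ℝ 2 (lapIter n j (Wf n a q)) := by
        intro q
        rw [lapIter_Wf ha]
        exact ContDiff.sum fun i _ => contDiff_const.mul (Wf_contDiff ha _)
      have := lap_sum Finset.univ ![2*p, -p]
        ![lapIter n j (Wf n a (p+1)), lapIter n j (Wf n a p)]
        (by intro i _; fin_cases i <;> simp [hcd])
      simpa using this
  rw [hlin]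
  have h1 := lapIter_W1 (k := k) ha p hp x
  have h2 := lapIter_W2 hk ha p hp x
  rw [hone] at h1 h2
  have hw := Wf_pos' ha x
  have hUp : bubble n k x ^ (2*(n:ℝ)/((n:ℝ) - 2*k) - 2) = (1 + a * ‖x‖^2)^(-(2*(k:ℝ))) := by
    rw [hU, Wf, ← Real.rpow_mul hw.le]
    congr 1
    rw [hp2, show (n:ℝ) = 2 * p + 2 * k by rw [hp]; ring]
    field_simp
    ring
  have hsh : ∀ q, Wf n a (q + 2*k) x = (1 + a * ‖x‖^2)^(-(2*(k:ℝ))) * Wf n a q x := by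
    intro q
    unfold Wf
    rw [← Real.rpow_add hw]; congr 1; ring
  have hco : 2*(n:ℝ)/((n:ℝ) - 2*k) - 1 = (p + 2*k)/p := by
    rw [hp2, show (n:ℝ) = 2 * p + 2 * k by rw [hp]; ring]
    field_simp
    ring
  rw [hUp, hco]
  have e3 := hsh (p+1)
  rw [show p + 1 + 2 * (k:ℝ) = p + 2*k+1 by ring] at e3
  rw [hsh p] at h1 h2
  rw [e3] at h2
  have : (p + 2*k)/p * (1 + a * ‖x‖^2)^(-(2*(k:ℝ))) * (p * (2 * Wf n a (p+1) x - Wf n a p x))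
    = (p+2*k) * (1 + a * ‖x‖^2)^(-(2*(k:ℝ))) * (2 * Wf n a (p+1) x - Wf n a p x) := by
    field_simp
  rw [this]
  linear_combination 2 * h2 - p * h1
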